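/- Fix real numbers a > 0 and u. For every real s > 0 the function I₀ is differentiable at s and (u - 1)·I₁(s) = -4s(s + (u - 1)²)·I₀'(s) - s·I₀(s) - 2(s - u² + 1)/( √a·√((u + 1)² + s) ). -/

import Mathlib

open Real

/-- `I_ν(s) = (1/√(2a)) ∫₋₁¹ (t+u)ᵛ/(√(t+1)√((t+u)²+s)) dt`. -/
noncomputable def Inu (a u : ℝ) (ν : ℕ) (s : ℝ) : ℝ :=
  (1 / Real.sqrt (2 * a)) *
    ∫ t in (-1 : ℝ)..1, (t + u) ^ ν / (Real.sqrt (t + 1) * Real.sqrt ((t + u) ^ 2 + s))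

theorem intervalIntegrable_inv_sqrt_add_one :
    IntervalIntegrable (fun t : ℝ => (√(t + 1))⁻¹) MeasureTheory.volume (-1) 1 := by
  have h := (intervalIntegral.intervalIntegrable_rpow' (a := 0) (b := 2)
    (r := -(1 / 2 : ℝ)) (by norm_num)).comp_add_right 1
  norm_num at h
  refine h.congr fun t ht => ?_
  rw [Set.uIoc_of_le (by norm_num)] at ht
  have h0 : (0 : ℝ) ≤ t + 1 := by linarith [ht.1]
  rw [Real.sqrt_eq_rpow, ← Real.rpow_neg h0]

theorem Continuous.intervalIntegrable_mul_inv_sqrt_add_one {f : ℝ → ℝ} (hf : Continuous f) :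
    IntervalIntegrable (fun t : ℝ => f t * (√(t + 1))⁻¹) MeasureTheory.volume (-1) 1 :=
  intervalIntegrable_inv_sqrt_add_one.continuousOn_mul hf.continuousOn

theorem continuous_inv_sqrt_sq_add (u : ℝ) {s : ℝ} (hs : 0 < s) :
    Continuous fun t : ℝ => (√((t + u) ^ 2 + s))⁻¹ :=
  Continuous.inv₀ (by fun_prop) fun t => by positivity

theorem continuous_inv_sq_add (u : ℝ) {s : ℝ} (hs : 0 < s) :
    Continuous fun t : ℝ => ((t + u) ^ 2 + s)⁻¹ :=
  Continuous.inv₀ (by fun_prop) fun t => by positivity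

theorem hasDerivAt_inv_sqrt_add (y : ℝ) {x : ℝ} (h : 0 < y + x) :
    HasDerivAt (fun x => (√(y + x))⁻¹) (-(1 / 2) * ((√(y + x))⁻¹ * (y + x)⁻¹)) x := by
  have hr : 0 < √(y + x) := Real.sqrt_pos.2 h
  have hd := (((hasDerivAt_id x).const_add y).sqrt h.ne').inv hr.ne'
  refine hd.congr_deriv ?_
  simp only [id]
  rw [Real.sq_sqrt h.le]
  field_simp

/-- Differentiation under the integral sign for `Inu a u 0`. -/
theorem hasDerivAt_Inu_zero (a u : ℝ) {s : ℝ} (hs : 0 < s) :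
    HasDerivAt (Inu a u 0)
      ((1 / √(2 * a)) * ∫ t in (-1 : ℝ)..1,
        (-(1 / 2) * ((√((t + u) ^ 2 + s))⁻¹ * ((t + u) ^ 2 + s)⁻¹)) * (√(t + 1))⁻¹) s := by
  have key := (intervalIntegral.hasDerivAt_integral_of_dominated_loc_of_deriv_le
    (μ := MeasureTheory.volume) (a := (-1 : ℝ)) (b := 1)
    (F := fun x t => (√((t + u) ^ 2 + x))⁻¹ * (√(t + 1))⁻¹)
    (F' := fun x t =>
      (-(1 / 2) * ((√((t + u) ^ 2 + x))⁻¹ * ((t + u) ^ 2 + x)⁻¹)) * (√(t + 1))⁻¹)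
    (x₀ := s) (s := Set.Ioi (s / 2))
    (bound := fun t => (1 / 2 * ((√(s / 2))⁻¹ * (s / 2)⁻¹)) * (√(t + 1))⁻¹)
    (Ioi_mem_nhds (by linarith)) ?_ ?_ ?_ ?_ ?_ ?_).2
  · have h := key.const_mul (1 / √(2 * a))
    refine h.congr_of_eventuallyEq (Filter.Eventually.of_forall fun x => ?_)
    simp only [Inu, pow_zero, one_div, mul_inv_rev]
  · filter_upwards [Ioi_mem_nhds hs] with x hx
    exact ((continuous_inv_sqrt_sq_add u hx).intervalIntegrable_mul_inv_sqrt_add_one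
      ).aestronglyMeasurable_restrict_uIoc
  · exact (continuous_inv_sqrt_sq_add u hs).intervalIntegrable_mul_inv_sqrt_add_one
  · exact ((((continuous_inv_sqrt_sq_add u hs).mul (continuous_inv_sq_add u hs)).const_mul
      _).intervalIntegrable_mul_inv_sqrt_add_one).aestronglyMeasurable_restrict_uIoc
  · refine Filter.Eventually.of_forall fun t _ x hx => ?_
    have hx : s / 2 < x := hx
    have hle : s / 2 ≤ (t + u) ^ 2 + x := by nlinarith [sq_nonneg (t + u)]
    have hs2 : 0 < s / 2 := by linarith
    have hpos : 0 < (t + u) ^ 2 + x := hs2.trans_le hle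
    rw [neg_mul, neg_mul, norm_neg, Real.norm_of_nonneg (by positivity)]
    gcongr
  · exact intervalIntegrable_inv_sqrt_add_one.const_mul _
  · refine Filter.Eventually.of_forall fun t _ x hx => ?_
    have hx : s / 2 < x := hx
    exact (hasDerivAt_inv_sqrt_add _ (by nlinarith [sq_nonneg (t + u)])).mul_const _

theorem hasDerivAt_sqrt_mul_div_sqrt (u : ℝ) {s t : ℝ} (hs : 0 < s) (ht : 0 < t + 1) :
    HasDerivAt
      (fun t => √(t + 1) * (2 * (u - 1) * (t + u) - 2 * s) * (√((t + u) ^ 2 + s))⁻¹)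
      (((u - 1) * (t + u) + s - 2 * s * (s + (u - 1) ^ 2) * ((t + u) ^ 2 + s)⁻¹)
        * (√((t + u) ^ 2 + s))⁻¹ * (√(t + 1))⁻¹) t := by
  have hr : 0 < (t + u) ^ 2 + s := by positivity
  have hR : 0 < √((t + u) ^ 2 + s) := Real.sqrt_pos.2 hr
  have hW : 0 < √(t + 1) := Real.sqrt_pos.2 ht
  have h1 := ((hasDerivAt_id t).add_const 1).sqrt ht.ne'
  have h2 := (((hasDerivAt_id t).add_const u).const_mul (2 * (u - 1))).sub_const (2 * s)
  have h3 := (((((hasDerivAt_id t).add_const u).pow 2).add_const s).sqrt hr.ne').inv hR.ne'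
  refine ((h1.mul h2).mul h3).congr_deriv ?_
  simp only [id, Pi.pow_apply, Pi.mul_apply, Pi.inv_apply]
  have hWsq : √(t + 1) ^ 2 = t + 1 := Real.sq_sqrt ht.le
  rw [Real.sq_sqrt hr.le]
  field_simp
  rw [hWsq]
  norm_num
  ring

theorem integral_eq_boundary_term (u : ℝ) {s : ℝ} (hs : 0 < s) :
    ∫ t in (-1 : ℝ)..1,
      ((u - 1) * (t + u) + s - 2 * s * (s + (u - 1) ^ 2) * ((t + u) ^ 2 + s)⁻¹)
        * (√((t + u) ^ 2 + s))⁻¹ * (√(t + 1))⁻¹ =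
      √2 * (2 * (u - 1) * (1 + u) - 2 * s) * (√((1 + u) ^ 2 + s))⁻¹ := by
  have hc := continuous_inv_sqrt_sq_add u hs
  have hc' := continuous_inv_sq_add u hs
  rw [intervalIntegral.integral_eq_sub_of_hasDerivAt_of_le (by norm_num)
    (f := fun t => √(t + 1) * (2 * (u - 1) * (t + u) - 2 * s) * (√((t + u) ^ 2 + s))⁻¹)
    (by fun_prop) (fun t ht => hasDerivAt_sqrt_mul_div_sqrt u hs (by linarith [ht.1]))
    (Continuous.intervalIntegrable_mul_inv_sqrt_add_one (by fun_prop))]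
  norm_num

/-- for `a > 0` and `s > 0`, `I₀` is differentiable at `s` and
`(u-1) I₁(s) = -4s(s+(u-1)²) I₀'(s) - s I₀(s) - 2(s-u²+1)/(√a √((u+1)²+s))`. -/
theorem stmt18 (a u : ℝ) (ha : 0 < a) (s : ℝ) (hs : 0 < s) :
    DifferentiableAt ℝ (Inu a u 0) s ∧
    (u - 1) * Inu a u 1 s =
      -4 * s * (s + (u - 1) ^ 2) * deriv (Inu a u 0) s - s * Inu a u 0 s -
        2 * (s - u ^ 2 + 1) / (Real.sqrt a * Real.sqrt ((u + 1) ^ 2 + s)) := by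
  have hD := hasDerivAt_Inu_zero a u hs
  refine ⟨hD.differentiableAt, ?_⟩
  have hc := continuous_inv_sqrt_sq_add u hs
  have hc' := continuous_inv_sq_add u hs
  have i0 := hc.intervalIntegrable_mul_inv_sqrt_add_one
  have i1 := Continuous.intervalIntegrable_mul_inv_sqrt_add_one
    (f := fun t => (t + u) * (√((t + u) ^ 2 + s))⁻¹) (by fun_prop)
  have i2 := Continuous.intervalIntegrable_mul_inv_sqrt_add_one
    (f := fun t => -(1 / 2) * ((√((t + u) ^ 2 + s))⁻¹ * ((t + u) ^ 2 + s)⁻¹)) (by fun_prop)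
  have hsplit : (u - 1) * (∫ t in (-1 : ℝ)..1, (t + u) * (√((t + u) ^ 2 + s))⁻¹ * (√(t + 1))⁻¹)
      + s * (∫ t in (-1 : ℝ)..1, (√((t + u) ^ 2 + s))⁻¹ * (√(t + 1))⁻¹)
      + 4 * s * (s + (u - 1) ^ 2) * (∫ t in (-1 : ℝ)..1,
        (-(1 / 2) * ((√((t + u) ^ 2 + s))⁻¹ * ((t + u) ^ 2 + s)⁻¹)) * (√(t + 1))⁻¹) =
      √2 * (2 * (u - 1) * (1 + u) - 2 * s) * (√((1 + u) ^ 2 + s))⁻¹ := by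
    rw [← integral_eq_boundary_term u hs, ← intervalIntegral.integral_const_mul,
      ← intervalIntegral.integral_const_mul, ← intervalIntegral.integral_const_mul,
      ← intervalIntegral.integral_add (i1.const_mul _) (i0.const_mul _),
      ← intervalIntegral.integral_add ((i1.const_mul _).add (i0.const_mul _)) (i2.const_mul _)]
    congr 1
    ext t
    ring
  have e0 : Inu a u 0 s = (1 / √(2 * a)) *
      ∫ t in (-1 : ℝ)..1, (√((t + u) ^ 2 + s))⁻¹ * (√(t + 1))⁻¹ := by
    simp only [Inu, pow_zero, one_div, mul_inv_rev]
  have e1 : Inu a u 1 s = (1 / √(2 * a)) *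
      ∫ t in (-1 : ℝ)..1, (t + u) * (√((t + u) ^ 2 + s))⁻¹ * (√(t + 1))⁻¹ := by
    simp only [Inu, pow_one, div_eq_mul_inv, mul_inv_rev, mul_assoc]
  have hb : 2 * (s - u ^ 2 + 1) / (√a * √((u + 1) ^ 2 + s)) =
      -((1 / √(2 * a)) *
        (√2 * (2 * (u - 1) * (1 + u) - 2 * s) * (√((1 + u) ^ 2 + s))⁻¹)) := by
    have h2 : 0 < √(2 : ℝ) := by positivity
    have hA : 0 < √a := Real.sqrt_pos.2 ha
    have hR : 0 < √((1 + u) ^ 2 + s) := Real.sqrt_pos.2 (by positivity)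
    rw [Real.sqrt_mul (by norm_num), add_comm u 1]
    field_simp
    ring
  rw [hD.deriv, e0, e1, hb, ← hsplit]
  ring
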